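/- arXiv:1810.01293 — 2 statements merged into one kernel-verified Lean document; each statement's English description precedes it below -/
import Mathlib

section
/- Let D be a finite set of positive integers, q : D → ℝ with q_k > 0 for all k ∈ D and Σ_{k∈D} q_k = 1, and let c_k > 0 for each k ∈ D. Then the game Γ(D, q, {c_k}) possesses a degree-based equilibrium: there exists δ* with δ*_k ∈ [0, 1/c_k] for every k ∈ D such that J_k(δ*) ≤ J_k(s, δ*_{-k}) for every k ∈ D and every s ∈ [0, 1/c_k]. -/
open Classical in
/-- The endemic-state neighbor infection probability `v(δ)`: a solution `v ∈ (0,1]` of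
the consistency equation `Σ_{i∈D} i q_i / (δ_i + i v) = 1` if one exists (it is then
unique for nonnegative curing rates), and `0` otherwise. -/
noncomputable def vstar (D : Finset ℕ) (q : ℕ → ℝ) (δ : ℕ → ℝ) : ℝ :=
  if h : ∃ v : ℝ, v ∈ Set.Ioc (0 : ℝ) 1 ∧
      ∑ i ∈ D, (i : ℝ) * q i / (δ i + (i : ℝ) * v) = 1 then h.choose else 0

/-- The steady-state infection probability of degree-`k` nodes:
`x_k(δ) = k v(δ) / (δ_k + k v(δ))` if `v(δ) > 0`, and `0` otherwise. -/
noncomputable def xinf (D : Finset ℕ) (q : ℕ → ℝ) (δ : ℕ → ℝ) (k : ℕ) : ℝ :=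
  if 0 < vstar D q δ then (k : ℝ) * vstar D q δ / (δ k + (k : ℝ) * vstar D q δ) else 0

/-- The expected cost of degree-`k` nodes: `J_k(δ) = x_k(δ) + c_k δ_k`. -/
noncomputable def cost (D : Finset ℕ) (q : ℕ → ℝ) (c : ℕ → ℝ) (δ : ℕ → ℝ) (k : ℕ) : ℝ :=
  xinf D q δ k + c k * δ k

lemma aux_phi_lt (D : Finset ℕ) (hne : D.Nonempty) (hD : ∀ k ∈ D, 0 < k)
    (q : ℕ → ℝ) (hq : ∀ k ∈ D, 0 < q k) (δ δ' : ℕ → ℝ)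
    (hδ : ∀ k ∈ D, δ k ≤ δ' k) (v v' : ℝ) (hpos : ∀ k ∈ D, 0 < δ k + k * v) (hv : v < v') :
    ∑ i ∈ D, (i : ℝ) * q i / (δ' i + (i : ℝ) * v') <
      ∑ i ∈ D, (i : ℝ) * q i / (δ i + (i : ℝ) * v) := by
  apply Finset.sum_lt_sum_of_nonempty hne
  intro i hi
  have h1 : (0 : ℝ) < i := by exact_mod_cast hD i hi
  have h2 := hq i hi
  have h3 := hδ i hi
  have h4 := hpos i hi
  have h5 : (i : ℝ) * v < i * v' := by gcongr
  apply div_lt_div_of_pos_left (by positivity) h4 (by linarith)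

/-- Case analysis for `vstar`. -/
lemma aux_vstar_cases (D : Finset ℕ) (hne : D.Nonempty) (hD : ∀ k ∈ D, 0 < k)
    (q : ℕ → ℝ) (hq : ∀ k ∈ D, 0 < q k) (hqsum : ∑ k ∈ D, q k = 1) (δ : ℕ → ℝ)
    (hδ : ∀ k ∈ D, 0 ≤ δ k) :
    (0 < vstar D q δ ∧ ∑ i ∈ D, (i : ℝ) * q i / (δ i + (i : ℝ) * vstar D q δ) = 1) ∨
    (vstar D q δ = 0 ∧ ∀ ε : ℝ, 0 < ε → ε ≤ 1 →
      ∑ i ∈ D, (i : ℝ) * q i / (δ i + (i : ℝ) * ε) ≤ 1) := by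
  by_cases h : ∃ v : ℝ, v ∈ Set.Ioc (0 : ℝ) 1 ∧
      ∑ i ∈ D, (i : ℝ) * q i / (δ i + (i : ℝ) * v) = 1
  · left
    have e : vstar D q δ = h.choose := by unfold vstar; rw [dif_pos h]
    have := h.choose_spec
    rw [← e] at this
    exact ⟨this.1.1, this.2⟩
  · right
    refine ⟨by unfold vstar; rw [dif_neg h], ?_⟩
    intro ε h0 h1
    by_contra! hcon
    apply h
    have hc : ContinuousOn (fun v : ℝ => ∑ i ∈ D, (i : ℝ) * q i / (δ i + (i : ℝ) * v))
        (Set.Icc ε 1) := by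
      apply continuousOn_finsetSum
      intro i hi
      apply ContinuousOn.div (by fun_prop) (by fun_prop)
      intro x hx
      have h1 : (0 : ℝ) < i := by exact_mod_cast hD i hi
      have := hδ i hi
      have : 0 < x := lt_of_lt_of_le h0 hx.1
      positivity
    have hle : ∑ i ∈ D, (i : ℝ) * q i / (δ i + (i : ℝ) * 1) ≤ 1 := by
      refine le_trans ?_ hqsum.le
      apply Finset.sum_le_sum
      intro i hi
      have h1 : (0 : ℝ) < i := by exact_mod_cast hD i hi
      have h2 := hδ i hi
      have h3 := hq i hi
      rw [div_le_iff₀ (by positivity)]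
      nlinarith [mul_nonneg h2 h3.le]
    obtain ⟨x, hx, hx2⟩ := intermediate_value_Icc' h1 hc ⟨hle, hcon.le⟩
    exact ⟨x, ⟨lt_of_lt_of_le h0 hx.1, hx.2⟩, hx2⟩

lemma aux_limit (A B : ℝ) (h : ∀ ε : ℝ, 0 < ε → ε ≤ 1 → 0 ≤ A + B * ε) : 0 ≤ A := by
  have h1 : Filter.Tendsto (fun ε : ℝ => A + B * ε) (nhdsWithin 0 (Set.Ioi 0)) (nhds A) := by
    have : Filter.Tendsto (fun ε : ℝ => A + B * ε) (nhds 0) (nhds (A + B * 0)) :=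
      Continuous.tendsto (by fun_prop) 0
    simp only [mul_zero, add_zero] at this
    exact this.mono_left nhdsWithin_le_nhds
  refine ge_of_tendsto h1 ?_
  filter_upwards [Ioc_mem_nhdsGT (show (0 : ℝ) < 1 by norm_num)] with ε hε
  exact h ε hε.1 hε.2

lemma aux_closed_graph {X Y : Type*} [TopologicalSpace X] [TopologicalSpace Y] [CompactSpace Y]
    (f : X × Y → ℝ) (hf : Continuous f) (g : X → Y) (hg : ∀ x y, f (x, y) = 0 ↔ y = g x) :
    Continuous g := by
  rw [continuous_iff_isClosed]
  intro C hC
  have h1 : IsClosed ({p : X × Y | f p = 0} ∩ (Prod.snd ⁻¹' C)) :=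
    (isClosed_eq hf continuous_const).inter (hC.preimage continuous_snd)
  have h2 := isClosedMap_fst_of_compactSpace _ h1
  convert h2 using 1
  ext x
  simp only [Set.mem_preimage, Set.mem_image, Set.mem_inter_iff, Set.mem_ofPred_eq, Prod.exists]
  constructor
  · intro h
    exact ⟨x, g x, ⟨(hg _ _).2 rfl, h⟩, rfl⟩
  · rintro ⟨a, b, ⟨h3, h4⟩, rfl⟩
    rw [(hg _ _).1 h3] at h4
    exact h4

/-- concavity tangent inequality -/
lemma aux_tan1 (y v v' y' : ℝ) (hy : 0 < y) (hvy : v * y ≤ 1) (hv' : 0 ≤ v')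
    (hy' : 0 < y') (h : 1 / y' = 1 / y - v + v') :
    v' * y' ≤ v * y + (v' - v) * (y - v * y ^ 2) := by
  have e : y = y' * (1 + (v' - v) * y) := by
    field_simp at h
    linarith
  have h1 : v * y + (v' - v) * (y - v * y ^ 2) - v' * y'
      = (1 - v * y) * (v' - v)^2 * y * y' := by
    have e2 : y' * y * (v' - v) = y - y' := by linear_combination -e
    linear_combination (-(v + (1 - v * y) * (v' - v))) * e2
  have : 0 ≤ (1 - v * y) * (v' - v)^2 * y * y' := by
    have : 0 ≤ 1 - v * y := by linarith
    positivity
  linarith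

lemma aux_tan2 (y v v' y' : ℝ) (hy : 0 < y)
    (hy' : 0 < y') (h : 1 / y' = 1 / y - v + v') :
    y - (v' - v) * y ^ 2 ≤ y' := by
  have e : y = y' * (1 + (v' - v) * y) := by
    field_simp at h
    linarith
  have e2 : y' * y * (v' - v) = y - y' := by linear_combination -e
  have h1 : y' - (y - (v' - v) * y ^ 2) = (v' - v) ^ 2 * y ^ 2 * y' := by
    linear_combination (- (v' - v) * y + 1) * e2
  have : 0 ≤ (v' - v) ^ 2 * y ^ 2 * y' := by positivity
  linarith

lemma aux_h_mono (w q a b : ℝ) (hw : 0 ≤ w) (hq : 0 < q) (ha : 0 ≤ a) (hab : a < b)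
    (hwb : w * b ≤ 1) :
    max (w * a ^ 2 * (1 - q * a ^ 2)) 0 + q * a ^ 3 <
      max (w * b ^ 2 * (1 - q * b ^ 2)) 0 + q * b ^ 3 := by
  have hb : 0 < b := lt_of_le_of_lt ha hab
  have h3 : q * a ^ 3 < q * b ^ 3 := by gcongr
  rcases le_total (w * a ^ 2 * (1 - q * a ^ 2)) 0 with h | h
  · rw [max_eq_right h]
    have := le_max_right (w * b ^ 2 * (1 - q * b ^ 2)) 0
    linarith
  · rw [max_eq_left h]
    rcases le_total (q * b ^ 2) 1 with h1 | h1
    · have := le_max_left (w * b ^ 2 * (1 - q * b ^ 2)) 0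
      have key : 0 < (b - a) * (w * (a + b) * (1 - q * b ^ 2) + (1 - w * b) * (2 * q * a ^ 2)
          + w * (b - a) * q * a ^ 2 + q * (b - a) * (b + 2 * a) + q * a ^ 2) := by
        have i1 : 0 < b - a := by linarith
        have i2 : 0 ≤ 1 - q * b ^ 2 := by linarith
        have i3 : 0 ≤ 1 - w * b := by linarith
        positivity
      nlinarith [key, this]
    · have := le_max_right (w * b ^ 2 * (1 - q * b ^ 2)) 0
      have i1 : w * a ^ 2 ≤ a := by
        have : w * a ≤ 1 := by nlinarith
        nlinarith
      have i2 : 1 - q * a ^ 2 ≤ q * (b ^ 2 - a ^ 2) := by linarith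
      have i3 : w * a ^ 2 * (1 - q * a ^ 2) ≤ a * (q * (b ^ 2 - a ^ 2)) := by
        have j : 0 ≤ q * (b ^ 2 - a ^ 2) := by
          have : a ^ 2 ≤ b ^ 2 := by gcongr
          have : 0 ≤ b ^ 2 - a ^ 2 := by linarith
          positivity
        calc _ ≤ w * a ^ 2 * (q * (b ^ 2 - a ^ 2)) := by gcongr
          _ ≤ _ := by gcongr
      have i4 : 0 < (b - a) * q * b ^ 2 := by
        have i1 : 0 < b - a := by linarith
        positivity
      nlinarith

/-- Sufficient conditions for an equilibrium. -/
lemma aux_verify (D : Finset ℕ) (hD : ∀ k ∈ D, 0 < k)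
    (q : ℕ → ℝ) (hq : ∀ k ∈ D, 0 < q k) (hqsum : ∑ k ∈ D, q k = 1)
    (c : ℕ → ℝ) (hc : ∀ k ∈ D, 0 < c k) (v : ℝ) (y : ℕ → ℝ) (hv : 0 ≤ v)
    (hy : ∀ k ∈ D, 0 < y k) (hvy : ∀ k ∈ D, v * y k ≤ 1) (hsum : ∑ k ∈ D, q k * y k = 1)
    (hF1 : ∀ k ∈ D, v = 0 ∨ q k * y k ^ 3 * (1 - v * y k) +
      (∑ i ∈ D, q i * y i ^ 2) * (v * y k ^ 2 - c k * k) ≤ 0)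
    (hF2 : ∀ k ∈ D, v * y k = 1 ∨ 0 ≤ q k * y k ^ 3 * (1 - v * y k) +
      (∑ i ∈ D, q i * y i ^ 2) * (v * y k ^ 2 - c k * k)) :
    ∃ δstar : ℕ → ℝ,
      (∀ k ∈ D, δstar k ∈ Set.Icc (0 : ℝ) (1 / c k)) ∧
      ∀ k ∈ D, ∀ s ∈ Set.Icc (0 : ℝ) (1 / c k),
        cost D q c δstar k ≤ cost D q c (Function.update δstar k s) k := by
  have hne : D.Nonempty := by
    rw [Finset.nonempty_iff_ne_empty]
    rintro rfl
    simp at hqsum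
  set δ : ℕ → ℝ := fun k => k * (1 / y k - v) with hδdef
  have hk : ∀ k ∈ D, (0 : ℝ) < k := fun k h => by exact_mod_cast hD k h
  have hδ0 : ∀ k ∈ D, 0 ≤ δ k := by
    intro k h
    have h1 : v ≤ 1 / y k := by
      rw [le_div_iff₀ (hy k h)]
      exact hvy k h
    have := hk k h
    have h2 : 0 ≤ 1 / y k - v := by linarith
    positivity
  have hden : ∀ k ∈ D, δ k + k * v = k / y k := by
    intro k h
    simp only [hδdef]
    ring
  have hdpos : ∀ k ∈ D, 0 < δ k + k * v := by
    intro k h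
    rw [hden k h]
    exact div_pos (hk k h) (hy k h)
  have hphi : ∑ i ∈ D, (i : ℝ) * q i / (δ i + (i : ℝ) * v) = 1 := by
    rw [← hsum]
    apply Finset.sum_congr rfl
    intro i hi
    rw [hden i hi]
    have := hk i hi
    have := hy i hi
    field_simp
  have hvs : vstar D q δ = v := by
    rcases aux_vstar_cases D hne hD q hq hqsum δ hδ0 with ⟨h1, h2⟩ | ⟨h1, h2⟩
    · rcases lt_trichotomy (vstar D q δ) v with h | h | h
      · have := aux_phi_lt D hne hD q hq δ δ (fun _ _ => le_rfl) _ _ (fun k hkD => by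
          have := hk k hkD
          have := hδ0 k hkD
          positivity) h
        linarith
      · exact h
      · have := aux_phi_lt D hne hD q hq δ δ (fun _ _ => le_rfl) _ _ hdpos h
        linarith
    · rw [h1]
      by_contra hv0
      have hvp : 0 < v := lt_of_le_of_ne hv hv0
      have hm : 0 < min v 1 / 2 := by positivity
      have hm2 := min_le_left v 1
      have hm3 := min_le_right v 1
      have h3 := h2 (min v 1 / 2) hm (by linarith)
      have := aux_phi_lt D hne hD q hq δ δ (fun _ _ => le_rfl) (min v 1 / 2) v (fun k hkD => by
          have := hk k hkD
          have := hδ0 k hkD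
          positivity) (by linarith)
      linarith
  have hcost : ∀ k ∈ D, cost D q c δ k = v * y k + c k * k * (1 / y k - v) := by
    intro k h
    unfold cost xinf
    rw [hvs]
    have h1 := hk k h
    have h2 := hy k h
    split_ifs with h0
    · rw [hden k h]
      simp only [hδdef]
      field_simp
    · have : v = 0 := le_antisymm (not_lt.1 h0) hv
      simp only [hδdef, this]
      ring
  set S := ∑ i ∈ D, q i * y i ^ 2 with hS
  have hmain : ∀ k ∈ D, ∀ s : ℝ, 0 ≤ s →
      cost D q c δ k ≤ cost D q c (Function.update δ k s) k := by
    intro k hkD s hs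
    have hkp := hk k hkD
    have hyp := hy k hkD
    have hqp := hq k hkD
    have hcp := hc k hkD
    set δ' := Function.update δ k s with hδ'
    have hδk : δ' k = s := by simp [hδ']
    have hδi : ∀ i ∈ D.erase k, δ' i = δ i := by
      intro i hi
      simp [hδ', (Finset.mem_erase.1 hi).1]
    have hδ'0 : ∀ i ∈ D, 0 ≤ δ' i := by
      intro i hi
      by_cases h : i = k
      · rw [h, hδk]; exact hs
      · rw [hδi i (Finset.mem_erase.2 ⟨h, hi⟩)]; exact hδ0 i hi
    have eS : S = q k * y k ^ 2 + ∑ i ∈ D.erase k, q i * y i ^ 2 := by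
      exact (Finset.add_sum_erase D (fun i => q i * y i ^ 2) hkD).symm
    have e1 : 1 = q k * y k + ∑ i ∈ D.erase k, q i * y i := by
      rw [← hsum]
      exact (Finset.add_sum_erase D (fun i => q i * y i) hkD).symm
    have hR : 0 ≤ S - q k * y k ^ 2 := by
      rw [eS]
      have : 0 ≤ ∑ i ∈ D.erase k, q i * y i ^ 2 := Finset.sum_nonneg fun i hi => by
        have := hq i (Finset.mem_of_mem_erase hi)
        positivity
      linarith
    -- the others
    have hoth : ∀ u : ℝ, 0 < u → ∀ i ∈ D.erase k,
        v * y i + (u - v) * (y i - v * y i ^ 2) ≥ u * (i / (δ' i + i * u)) ∧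
        y i - (u - v) * y i ^ 2 ≤ (i / (δ' i + i * u)) := by
      intro u hu i hi
      have hiD := Finset.mem_of_mem_erase hi
      have h1 := hk i hiD
      have h2 := hδ0 i hiD
      have h3 := hy i hiD
      rw [hδi i hi]
      have hp : 0 < δ i + i * u := by positivity
      have he : 1 / ((i : ℝ) / (δ i + i * u)) = 1 / y i - v + u := by
        rw [one_div_div]
        simp only [hδdef]
        field_simp
      exact ⟨aux_tan1 _ _ _ _ h3 (hvy i hiD) hu.le (by positivity) he,
        aux_tan2 _ _ _ _ h3 (by positivity) he⟩
    have hsplit : ∀ u : ℝ, ∑ i ∈ D, (i : ℝ) * q i / (δ' i + (i : ℝ) * u) =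
        q k * (k / (s + k * u)) + ∑ i ∈ D.erase k, q i * (i / (δ' i + i * u)) := by
      intro u
      rw [← Finset.add_sum_erase _ _ hkD, hδk]
      congr 1
      · ring
      · exact Finset.sum_congr rfl fun i _ => by ring
    -- bound on 1 / y'
    have hinv : ∀ u : ℝ, 0 < u → ∑ i ∈ D, (i : ℝ) * q i / (δ' i + (i : ℝ) * u) ≤ 1 →
        1 / y k - (u - v) * ((S - q k * y k ^ 2) / (q k * y k ^ 2)) ≤ (s + k * u) / k := by
      intro u hu hle
      rw [hsplit] at hle
      have h1 : ∑ i ∈ D.erase k, (q i * y i - (u - v) * (q i * y i ^ 2)) ≤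
          ∑ i ∈ D.erase k, q i * (i / (δ' i + i * u)) := by
        apply Finset.sum_le_sum
        intro i hi
        have := (hoth u hu i hi).2
        have := mul_le_mul_of_nonneg_left this (hq i (Finset.mem_of_mem_erase hi)).le
        linarith
      rw [Finset.sum_sub_distrib, ← Finset.mul_sum] at h1
      have hp : 0 < s + k * u := by positivity
      set z := (k : ℝ) / (s + k * u) with hz
      have hzp : 0 < z := by positivity
      have hzi : (s + k * u) / k = 1 / z := by rw [hz, one_div_div]
      rw [hzi]
      have h2 : q k * z ≤ q k * y k + (u - v) * (S - q k * y k ^ 2) := by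
        have : S - q k * y k ^ 2 = ∑ i ∈ D.erase k, q i * y i ^ 2 := by rw [eS]; ring
        rw [this]
        linarith
      have h3 : 2 / y k - z / y k ^ 2 ≤ 1 / z := by
        rw [← sub_nonneg]
        have : 1 / z - (2 / y k - z / y k ^ 2) = (y k - z) ^ 2 / (z * y k ^ 2) := by
          field_simp
          ring
        rw [this]
        positivity
      have h4 : 1 / y k - (u - v) * ((S - q k * y k ^ 2) / (q k * y k ^ 2)) ≤
          2 / y k - z / y k ^ 2 := by
        rw [← sub_nonneg]
        have : 2 / y k - z / y k ^ 2 -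
          (1 / y k - (u - v) * ((S - q k * y k ^ 2) / (q k * y k ^ 2))) =
          (q k * y k + (u - v) * (S - q k * y k ^ 2) - q k * z) / (q k * y k ^ 2) := by
          field_simp
          ring
        rw [this]
        apply div_nonneg (by linarith) (by positivity)
      linarith
    rw [hcost k hkD]
    rcases aux_vstar_cases D hne hD q hq hqsum δ' hδ'0 with ⟨h1, h2⟩ | ⟨h1, h2⟩
    · unfold cost xinf
      rw [if_pos h1, hδk]
      set u := vstar D q δ' with hu
      have hI := hinv u h1 h2.le
      have hp : 0 < s + k * u := by positivity
      have hX : v * y k + (u - v) * (y k + v * ((S - q k * y k ^ 2) / q k)) ≤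
          k * u / (s + k * u) := by
        rw [hsplit] at h2
        have h3 : ∑ i ∈ D.erase k, u * (q i * (i / (δ' i + i * u))) ≤
            ∑ i ∈ D.erase k, (u * (q i * y i) - (u - v) * v * (q i * y i ^ 2)) := by
          apply Finset.sum_le_sum
          intro i hi
          have := (hoth u h1 i hi).1
          have := mul_le_mul_of_nonneg_left this (hq i (Finset.mem_of_mem_erase hi)).le
          linarith
        rw [Finset.sum_sub_distrib, ← Finset.mul_sum, ← Finset.mul_sum, ← Finset.mul_sum] at h3
        have h4 : S - q k * y k ^ 2 = ∑ i ∈ D.erase k, q i * y i ^ 2 := by rw [eS]; ring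
        rw [← h4] at h3
        have e5 : ∑ i ∈ D.erase k, q i * (i / (δ' i + i * u)) = 1 - q k * (k / (s + k * u)) := by
          linarith
        have e6 : ∑ i ∈ D.erase k, q i * y i = 1 - q k * y k := by linarith
        rw [e5, e6] at h3
        rw [← sub_nonneg]
        have : k * u / (s + k * u) -
          (v * y k + (u - v) * (y k + v * ((S - q k * y k ^ 2) / q k))) =
          (u * (1 - q k * y k) - (u - v) * v * (S - q k * y k ^ 2) -
            u * (1 - q k * (k / (s + k * u)))) / q k := by
          field_simp
          ring
        rw [this]
        exact div_nonneg (by linarith) hqp.le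
      set F := q k * y k ^ 3 * (1 - v * y k) + S * (v * y k ^ 2 - c k * k) with hF
      have hFs : 0 ≤ (u - v) * F := by
        rcases lt_trichotomy u v with h | h | h
        · have : F ≤ 0 := by
            rcases hF1 k hkD with h0 | h0
            · linarith
            · exact h0
          nlinarith
        · rw [h]; simp
        · have : 0 ≤ F := by
            rcases hF2 k hkD with h0 | h0
            · exfalso
              have hz : δ k = 0 := by
                simp only [hδdef]
                have : 1 / y k = v := by
                  rw [div_eq_iff hyp.ne']; exact h0.symm
                rw [this]; ring
              have := aux_phi_lt D hne hD q hq δ δ' (fun i hi => by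
                by_cases hik : i = k
                · rw [hik, hδk, hz]; exact hs
                · rw [hδi i (Finset.mem_erase.2 ⟨hik, hi⟩)]) v u hdpos h
              linarith
            · exact h0
          have : 0 ≤ u - v := by linarith
          positivity
      have hF' : 0 ≤ (u - v) * F / (q k * y k ^ 2) := by positivity
      have hI2 := mul_le_mul_of_nonneg_left hI (mul_pos hcp hkp).le
      have e7 : c k * k * ((s + k * u) / k) = c k * s + c k * k * u := by
        field_simp
      rw [e7] at hI2
      have e8 : (u - v) * F / (q k * y k ^ 2) =
          (u - v) * (y k + v * ((S - q k * y k ^ 2) / q k)) -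
          c k * k * ((u - v) * ((S - q k * y k ^ 2) / (q k * y k ^ 2))) - c k * k * (u - v) := by
        rw [hF]
        field_simp
        ring
      linarith
    · unfold cost xinf
      rw [if_neg (by rw [h1]; exact lt_irrefl _), hδk]
      set R := (S - q k * y k ^ 2) / (q k * y k ^ 2) with hRdef
      have hlim := aux_limit (s / k - 1 / y k - v * R) (1 + R) (by
        intro ε h0 h3
        have := hinv ε h0 (h2 ε h0 h3)
        have e : (s + k * ε) / k = s / k + ε := by field_simp
        rw [e] at this
        linarith)
      have h4 : v * y k ≤ c k * k * v * (R + 1) := by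
        rcases hF1 k hkD with h0 | h0
        · rw [h0]; simp
        · have e : c k * k * v * (R + 1) - v * y k =
            v * (v * y k ^ 2 * (S - q k * y k ^ 2) - (q k * y k ^ 3 * (1 - v * y k) +
              S * (v * y k ^ 2 - c k * k))) / (q k * y k ^ 2) := by
            rw [hRdef]
            field_simp
            ring
          rw [← sub_nonneg, e]
          have : 0 ≤ v * y k ^ 2 * (S - q k * y k ^ 2) := by positivity
          apply div_nonneg (mul_nonneg hv (by linarith)) (by positivity)
      have h5 := mul_nonneg (mul_pos hcp hkp).le hlim
      have e9 : c k * k * (s / k - 1 / y k - v * R) =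
        c k * s - c k * k * (1 / y k) - c k * k * (v * R) := by
        field_simp
      rw [e9] at h5
      linarith
  refine ⟨δ, ?_, fun k hkD s hs => hmain k hkD s hs.1⟩
  intro k hkD
  refine ⟨hδ0 k hkD, ?_⟩
  have h1 := hmain k hkD 0 le_rfl
  have hkp := hk k hkD
  have hyp := hy k hkD
  rw [hcost k hkD] at h1
  have h2 : cost D q c (Function.update δ k 0) k ≤ 1 := by
    unfold cost xinf
    simp only [Function.update_self, mul_zero, add_zero, zero_add]
    split_ifs
    · exact div_self_le_one _
    · exact zero_le_one
  rw [le_div_iff₀ (hc k hkD)]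
  have h3 : 0 ≤ v * y k := by positivity
  simp only [hδdef]
  linarith

/-- The defining function for the scaled variable. -/
noncomputable def auxM (q e w ρ t : ℝ) : ℝ :=
  min (e * ρ - (max (w * t ^ 2 * (1 - q * t ^ 2)) 0 + q * t ^ 3)) (1 - w * t)

lemma auxM_uniq_aux (q e w ρ a b : ℝ) (hw : 0 ≤ w) (hq : 0 < q) (ha : 0 ≤ a) (hab : a < b)
    (h1 : auxM q e w ρ a = 0) (h2 : auxM q e w ρ b = 0) : False := by
  unfold auxM at h1 h2
  have hb1 := h2 ▸ min_le_left (e * ρ - (max (w * b ^ 2 * (1 - q * b ^ 2)) 0 + q * b ^ 3)) (1 - w * b)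
  have hb2 := h2 ▸ min_le_right (e * ρ - (max (w * b ^ 2 * (1 - q * b ^ 2)) 0 + q * b ^ 3)) (1 - w * b)
  have hm := aux_h_mono w q a b hw hq ha hab (by linarith)
  have hwa : 0 < 1 - w * a := by
    rcases hw.eq_or_lt with h | h
    · rw [← h]; norm_num
    · nlinarith
  have : 0 < min (e * ρ - (max (w * a ^ 2 * (1 - q * a ^ 2)) 0 + q * a ^ 3)) (1 - w * a) :=
    lt_min (by linarith) hwa
  linarith

lemma auxM_uniq (q e w ρ a b : ℝ) (hw : 0 ≤ w) (hq : 0 < q) (ha : 0 ≤ a) (hb : 0 ≤ b)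
    (h1 : auxM q e w ρ a = 0) (h2 : auxM q e w ρ b = 0) : a = b := by
  rcases lt_trichotomy a b with h | h | h
  · exact (auxM_uniq_aux q e w ρ a b hw hq ha h h1 h2).elim
  · exact h
  · exact (auxM_uniq_aux q e w ρ b a hw hq hb h h2 h1).elim

lemma auxM_cont (q e : ℝ) : Continuous (fun p : (ℝ × ℝ) × ℝ => auxM q e p.1.1 p.1.2 p.2) := by
  unfold auxM
  fun_prop

lemma aux_T (q e ρ0 : ℝ) (hq : 0 < q) (he : 0 < e) (hρ : 0 < ρ0) :
    ∃ T : (Set.Icc (0 : ℝ) 1) × (Set.Icc ρ0 1) → ℝ, Continuous T ∧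
      ∀ x, 0 < T x ∧ auxM q e x.1 x.2 (T x) = 0 := by
  have hex : ∀ x : (Set.Icc (0 : ℝ) 1) × (Set.Icc ρ0 1), ∃ t : Set.Icc (0 : ℝ) (1 + e / q),
      auxM q e x.1 x.2 t = 0 := by
    rintro ⟨⟨w, hw⟩, ⟨ρ, hρ1⟩⟩
    have hc : Continuous (fun t : ℝ => auxM q e w ρ t) :=
      (auxM_cont q e).comp (by fun_prop : Continuous (fun t : ℝ => ((w, ρ), t)))
    have hM : (0 : ℝ) ≤ 1 + e / q := by positivity
    have hρp : 0 < ρ := lt_of_lt_of_le hρ hρ1.1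
    have h0 : 0 ≤ auxM q e w ρ 0 := by
      unfold auxM
      apply le_min
      · simp; positivity
      · simp
    have h1 : auxM q e w ρ (1 + e / q) ≤ 0 := by
      unfold auxM
      apply (min_le_left _ _).trans
      have h2 := le_max_right (w * (1 + e / q) ^ 2 * (1 - q * (1 + e / q) ^ 2)) 0
      have h3 : e * ρ ≤ e := by nlinarith [hρ1.2]
      have h4 : e ≤ q * (1 + e / q) ^ 3 := by
        have : 1 + e / q ≤ (1 + e / q) ^ 3 := le_self_pow₀ (by
          have : 0 < e / q := by positivity
          linarith) (by norm_num)
        calc e ≤ q * (1 + e / q) := by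
              have : q * (1 + e / q) = q + e := by field_simp
              linarith
          _ ≤ _ := by gcongr
      linarith
    obtain ⟨t, ht, ht2⟩ := intermediate_value_Icc' hM hc.continuousOn ⟨h1, h0⟩
    exact ⟨⟨t, ht⟩, ht2⟩
  choose g hg using hex
  refine ⟨fun x => g x, ?_, ?_⟩
  · apply Continuous.comp continuous_subtype_val
    refine aux_closed_graph (fun p : ((Set.Icc (0 : ℝ) 1) × (Set.Icc ρ0 1)) ×
      Set.Icc (0 : ℝ) (1 + e / q) => auxM q e p.1.1 p.1.2 p.2) ?_ g ?_
    · exact (auxM_cont q e).comp (by fun_prop : Continuous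
        (fun p : ((Set.Icc (0 : ℝ) 1) × (Set.Icc ρ0 1)) ×
          Set.Icc (0 : ℝ) (1 + e / q) => (((p.1.1 : ℝ), (p.1.2 : ℝ)), (p.2 : ℝ))))
    · intro x y
      constructor
      · intro h
        apply Subtype.ext
        exact auxM_uniq q e x.1 x.2 y (g x) x.1.2.1 hq y.2.1 (g x).2.1 h (hg x)
      · rintro rfl
        exact hg x
  · intro x
    refine ⟨lt_of_le_of_ne (g x).2.1 ?_, hg x⟩
    intro h
    have h1 := hg x
    have h' : (0 : ℝ) = g x := h
    rw [← h'] at h1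
    have hρp : (0 : ℝ) < x.2 := lt_of_lt_of_le hρ x.2.2.1
    have : 0 < auxM q e x.1 x.2 0 := by
      unfold auxM
      apply lt_min
      · simp; positivity
      · simp
    linarith

/-- Strict antitonicity in `w`. -/
lemma auxM_anti (q e w w' ρ a b : ℝ) (hw : 0 ≤ w) (hww : w < w') (hq : 0 < q) (ha : 0 < a)
    (hqa : q * a ^ 2 < 1)
    (h1 : auxM q e w ρ a = 0) (h2 : auxM q e w' ρ b = 0) : b < a := by
  by_contra! hab
  unfold auxM at h1 h2
  have hb1 := h2 ▸ min_le_left (e * ρ - (max (w' * b ^ 2 * (1 - q * b ^ 2)) 0 + q * b ^ 3)) (1 - w' * b)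
  have hb2 := h2 ▸ min_le_right (e * ρ - (max (w' * b ^ 2 * (1 - q * b ^ 2)) 0 + q * b ^ 3)) (1 - w' * b)
  have hm : max (w' * a ^ 2 * (1 - q * a ^ 2)) 0 + q * a ^ 3 ≤
      max (w' * b ^ 2 * (1 - q * b ^ 2)) 0 + q * b ^ 3 := by
    rcases hab.eq_or_lt with h | h
    · rw [h]
    · exact (aux_h_mono w' q a b (by linarith) hq ha.le h (by linarith)).le
  have hp : 0 < 1 - q * a ^ 2 := by linarith
  have hlt : w * a ^ 2 * (1 - q * a ^ 2) < w' * a ^ 2 * (1 - q * a ^ 2) := by gcongr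
  have h0 : 0 ≤ w * a ^ 2 * (1 - q * a ^ 2) := by positivity
  rw [max_eq_left (by linarith)] at hm
  have : 0 < min (e * ρ - (max (w * a ^ 2 * (1 - q * a ^ 2)) 0 + q * a ^ 3)) (1 - w * a) := by
    rw [max_eq_left h0]
    apply lt_min (by linarith)
    have : w * a < w' * a := by gcongr
    have : w' * a ≤ w' * b := mul_le_mul_of_nonneg_left hab (by linarith)
    linarith
  linarith

lemma aux_core (D : Finset ℕ) (hnt : D.Nontrivial) (q e a : ℕ → ℝ)
    (hq : ∀ k ∈ D, 0 < q k) (hqsum : ∑ k ∈ D, q k = 1)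
    (ha : ∀ k ∈ D, 0 < a k) (hae : ∀ k ∈ D, q k * a k ^ 3 = e k)
    (hcase : 1 < (∑ k ∈ D, q k * a k) * (∑ k ∈ D, q k * a k ^ 2)) :
    ∃ (w ρ : ℝ) (τ : ℕ → ℝ), 0 ≤ w ∧ 0 < ρ ∧ (∀ k ∈ D, 0 < τ k) ∧
      ∑ k ∈ D, q k * τ k ^ 2 = 1 ∧ ∑ k ∈ D, q k * τ k = ρ ∧
      ∀ k ∈ D, auxM (q k) (e k) w ρ (τ k) = 0 := by
  have hne : D.Nonempty := hnt.nonempty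
  have he : ∀ k ∈ D, 0 < e k := fun k hk => by
    rw [← hae k hk]
    have := ha k hk
    have := hq k hk
    positivity
  -- Cauchy-Schwarz
  have hCS : ∀ t : ℕ → ℝ, ∑ k ∈ D, q k * t k ^ 2 = 1 → ∑ k ∈ D, q k * t k ≤ 1 := by
    intro t ht
    have : ∑ k ∈ D, q k * t k ≤ ∑ k ∈ D, (q k * t k ^ 2 + q k) / 2 := by
      apply Finset.sum_le_sum
      intro k hk
      nlinarith [hq k hk, mul_nonneg (hq k hk).le (sq_nonneg (t k - 1))]
    rw [← Finset.sum_div, Finset.sum_add_distrib, ht, hqsum] at this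
    linarith
  set A2 := ∑ k ∈ D, q k * a k ^ 2 with hA2
  have hA2p : 0 < A2 := Finset.sum_pos (fun k hk => by
    have := ha k hk
    have := hq k hk
    positivity) hne
  obtain ⟨b, hbp, hb⟩ : ∃ b : ℝ, 0 < b ∧ b ^ 2 * A2 = 1 := by
    refine ⟨1 / √A2, by positivity, ?_⟩
    rw [div_pow, Real.sq_sqrt hA2p.le]
    field_simp
  have hS0 : ∑ k ∈ D, q k * (b * a k) ^ 2 = 1 := by
    rw [← hb, hA2, Finset.mul_sum]
    exact Finset.sum_congr rfl fun k _ => by ring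
  have hb3 : b ^ 3 < ∑ k ∈ D, q k * (b * a k) := by
    have : ∑ k ∈ D, q k * (b * a k) = b * ∑ k ∈ D, q k * a k := by
      rw [Finset.mul_sum]
      exact Finset.sum_congr rfl fun k _ => by ring
    rw [this]
    have h2 : b ^ 2 < ∑ k ∈ D, q k * a k := by
      by_contra! h
      nlinarith
    nlinarith
  have hb1 : b ^ 3 ≤ 1 := by linarith [hCS _ hS0]
  have hb3p : 0 < b ^ 3 := by positivity
  have hTex : ∀ k, ∃ T : (Set.Icc (0 : ℝ) 1) × (Set.Icc (b ^ 3) 1) → ℝ, k ∈ D → Continuous T ∧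
      ∀ x, 0 < T x ∧ auxM (q k) (e k) x.1 x.2 (T x) = 0 := by
    intro k
    by_cases hk : k ∈ D
    · obtain ⟨T, hT⟩ := aux_T (q k) (e k) (b ^ 3) (hq k hk) (he k hk) hb3p
      exact ⟨T, fun _ => hT⟩
    · exact ⟨0, fun h => (hk h).elim⟩
  choose T hT using hTex
  let G : (Set.Icc (0 : ℝ) 1) × (Set.Icc (b ^ 3) 1) → ℝ := fun x => ∑ k ∈ D, q k * T k x ^ 2 - 1
  have hG : Continuous G := by
    apply Continuous.sub _ continuous_const
    apply continuous_finsetSum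
    intro k hk
    have := (hT k hk).1
    fun_prop
  let z0 : Set.Icc (0 : ℝ) 1 := ⟨0, by simp⟩
  let z1 : Set.Icc (0 : ℝ) 1 := ⟨1, by simp⟩
  -- at w = 0
  have hw0 : ∀ (ρ : Set.Icc (b ^ 3) 1), ∀ k ∈ D, b * a k ≤ T k (z0, ρ) := by
    intro ρ k hk
    have h1 := ((hT k hk).2 (z0, ρ)).2
    have hTp := ((hT k hk).2 (z0, ρ)).1
    simp only [auxM, z0, zero_mul, max_self, zero_add, sub_zero] at h1
    by_contra! hlt
    have h2 : q k * T k (z0, ρ) ^ 3 < q k * (b * a k) ^ 3 := by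
      have := hq k hk
      gcongr
    have h3 : q k * (b * a k) ^ 3 ≤ e k * ρ := by
      rw [← hae k hk]
      have h4 := ρ.2.1
      have := hq k hk
      have := ha k hk
      calc q k * (b * a k) ^ 3 = q k * a k ^ 3 * b ^ 3 := by ring
        _ ≤ _ := by gcongr
    have : 0 < min (e k * ρ - q k * T k (z0, ρ) ^ 3) 1 := lt_min (by linarith) one_pos
    simp only [z0] at this
    linarith
  have hG0 : ∀ (ρ : Set.Icc (b ^ 3) 1), 0 ≤ G (z0, ρ) := by
    intro ρ
    have : ∑ k ∈ D, q k * (b * a k) ^ 2 ≤ ∑ k ∈ D, q k * T k (z0, ρ) ^ 2 := by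
      apply Finset.sum_le_sum
      intro k hk
      have h1 := hw0 ρ k hk
      have := hq k hk
      have := ha k hk
      gcongr
    simp only [G]
    linarith
  have hG1 : ∀ (ρ : Set.Icc (b ^ 3) 1), G (z1, ρ) ≤ 0 := by
    intro ρ
    have : ∑ k ∈ D, q k * T k (z1, ρ) ^ 2 ≤ ∑ k ∈ D, q k := by
      apply Finset.sum_le_sum
      intro k hk
      have h1 := (hT k hk).2 (z1, ρ)
      have h2 : T k (z1, ρ) ≤ 1 := by
        have h3 := h1.2
        have : auxM (q k) (e k) z1 ρ (T k (z1, ρ)) ≤ 1 - z1 * (T k (z1, ρ)) := min_le_right _ _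
        simp only [h3, z1] at this
        simp only [z1]
        linarith
      have h4 : T k (z1, ρ) ^ 2 ≤ 1 := pow_le_one₀ h1.1.le h2
      have := hq k hk
      nlinarith
    simp only [G]
    linarith
  have hwex : ∀ ρ : Set.Icc (b ^ 3) 1, ∃ w : Set.Icc (0 : ℝ) 1, G (w, ρ) = 0 := by
    intro ρ
    have hc : Continuous (fun w => G (w, ρ)) := by fun_prop
    have := mem_range_of_exists_le_of_exists_ge hc ⟨z1, hG1 ρ⟩ ⟨z0, hG0 ρ⟩
    exact this
  have hlt1 : ∀ x, G x = 0 → ∀ k ∈ D, q k * T k x ^ 2 < 1 := by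
    intro x hx k hk
    obtain ⟨j, hj, hjk⟩ := hnt.exists_ne k
    simp only [G] at hx
    have h1 : ∑ i ∈ D, q i * T i x ^ 2 = 1 := by linarith
    rw [← h1]
    have hpos : ∀ i ∈ D, 0 < q i * T i x ^ 2 := fun i hi => by
      have := hq i hi
      have := ((hT i hi).2 x).1
      positivity
    exact Finset.single_lt_sum (f := fun i => q i * T i x ^ 2) hjk hk hj (hpos j hj)
      (fun i hi _ => (hpos i hi).le)
  have hanti : ∀ (w w' : Set.Icc (0 : ℝ) 1) (ρ : Set.Icc (b ^ 3) 1), G (w, ρ) = 0 →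
      G (w', ρ) = 0 → ¬ (w : ℝ) < w' := by
    intro w w' ρ h h' hlt
    have : ∑ k ∈ D, q k * T k (w', ρ) ^ 2 < ∑ k ∈ D, q k * T k (w, ρ) ^ 2 := by
      apply Finset.sum_lt_sum_of_nonempty hne
      intro k hk
      have h1 := (hT k hk).2 (w, ρ)
      have h2 := (hT k hk).2 (w', ρ)
      have h3 := auxM_anti (q k) (e k) w w' ρ _ _ w.2.1 hlt (hq k hk) h1.1 (hlt1 _ h k hk) h1.2 h2.2
      have := hq k hk
      have := h2.1
      gcongr
    simp only [G] at h h'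
    linarith
  choose W hW using hwex
  have hWc : Continuous W := by
    refine aux_closed_graph (fun p : (Set.Icc (b ^ 3) 1) × (Set.Icc (0 : ℝ) 1) => G (p.2, p.1))
      (by fun_prop) W ?_
    intro ρ w
    constructor
    · intro h
      apply Subtype.ext
      exact le_antisymm (not_lt.1 (hanti _ _ ρ (hW ρ) h)) (not_lt.1 (hanti _ _ ρ h (hW ρ)))
    · rintro rfl
      exact hW ρ
  let P : Set.Icc (b ^ 3) 1 → ℝ := fun ρ => ∑ k ∈ D, q k * T k (W ρ, ρ) - ρ
  have hP : Continuous P := by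
    apply Continuous.sub _ continuous_subtype_val
    apply continuous_finsetSum
    intro k hk
    have := (hT k hk).1
    fun_prop
  let r0 : Set.Icc (b ^ 3) 1 := ⟨b ^ 3, le_rfl, hb1⟩
  let r1 : Set.Icc (b ^ 3) 1 := ⟨1, hb1, le_rfl⟩
  have hGS : ∀ ρ, ∑ k ∈ D, q k * T k (W ρ, ρ) ^ 2 = 1 := by
    intro ρ
    have := hW ρ
    simp only [G] at this
    linarith
  have hP1 : P r1 ≤ 0 := by
    have := hCS _ (hGS r1)
    simp only [P, r1] at this ⊢
    linarith
  have hP0 : 0 ≤ P r0 := by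
    have hT0 : ∀ k ∈ D, T k (z0, r0) = b * a k := by
      intro k hk
      have h1 := (hT k hk).2 (z0, r0)
      refine auxM_uniq (q k) (e k) z0 r0 _ _ le_rfl (hq k hk) h1.1.le
        (mul_pos hbp (ha k hk)).le h1.2 ?_
      simp only [auxM, z0, r0, zero_mul, max_self, zero_add, sub_zero]
      rw [← hae k hk]
      have : q k * a k ^ 3 * b ^ 3 - q k * (b * a k) ^ 3 = 0 := by ring
      rw [this]
      simp
    have hGz : G (z0, r0) = 0 := by
      simp only [G]
      rw [Finset.sum_congr rfl (fun k hk => by rw [hT0 k hk]), hS0]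
      ring
    have hWz : W r0 = z0 := by
      apply Subtype.ext
      exact le_antisymm (not_lt.1 (hanti _ _ _ hGz (hW r0))) (not_lt.1 (hanti _ _ _ (hW r0) hGz))
    simp only [P]
    rw [hWz, Finset.sum_congr rfl (fun k hk => by rw [hT0 k hk])]
    simp only [r0]
    linarith
  have : PreconnectedSpace (Set.Icc (b ^ 3) 1) :=
    Subtype.preconnectedSpace isPreconnected_Icc
  obtain ⟨ρ, hρ⟩ := mem_range_of_exists_le_of_exists_ge hP ⟨r1, hP1⟩ ⟨r0, hP0⟩
  refine ⟨W ρ, ρ, fun k => T k (W ρ, ρ), (W ρ).2.1, lt_of_lt_of_le hb3p ρ.2.1,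
    fun k hk => ((hT k hk).2 _).1, hGS ρ, ?_, fun k hk => ((hT k hk).2 (W ρ, ρ)).2⟩
  simp only [P] at hρ
  linarith

/-- The game `Γ(D, q, {c_k})` in which nodes of degree `k` choose a
curing rate in `Δ_k = [0, 1/c_k]` to minimize `J_k(δ) = x_k(δ) + c_k δ_k` possesses a
degree-based equilibrium. -/
theorem dbe_exists_true_expectation
    (D : Finset ℕ) (hD : ∀ k ∈ D, 0 < k)
    (q : ℕ → ℝ) (hq : ∀ k ∈ D, 0 < q k) (hqsum : ∑ k ∈ D, q k = 1)
    (c : ℕ → ℝ) (hc : ∀ k ∈ D, 0 < c k) :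
    ∃ δstar : ℕ → ℝ,
      (∀ k ∈ D, δstar k ∈ Set.Icc (0 : ℝ) (1 / c k)) ∧
      ∀ k ∈ D, ∀ s ∈ Set.Icc (0 : ℝ) (1 / c k),
        cost D q c δstar k ≤ cost D q c (Function.update δstar k s) k := by
  have hne : D.Nonempty := by
    rw [Finset.nonempty_iff_ne_empty]
    rintro rfl
    simp at hqsum
  have hep : ∀ k ∈ D, 0 < c k * k := fun k hk => by
    have h1 : (0 : ℝ) < k := by exact_mod_cast hD k hk
    exact mul_pos (hc k hk) h1
  have hex : ∀ k, ∃ a : ℝ, k ∈ D → 0 < a ∧ q k * a ^ 3 = c k * k := by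
    intro k
    by_cases hk : k ∈ D
    · have h1 := hq k hk
      have h2 := hep k hk
      have h3 : 0 < c k * k / q k := by positivity
      refine ⟨(c k * k / q k) ^ ((1 : ℝ) / 3), fun _ => ⟨by positivity, ?_⟩⟩
      rw [← Real.rpow_natCast, ← Real.rpow_mul h3.le]
      norm_num
      field_simp
    · exact ⟨0, fun h => (hk h).elim⟩
  choose a ha using hex
  set A1 := ∑ k ∈ D, q k * a k with hA1
  set A2 := ∑ k ∈ D, q k * a k ^ 2 with hA2
  have hA1p : 0 < A1 := Finset.sum_pos (fun k hk => by
    have := (ha k hk).1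
    have := hq k hk
    positivity) hne
  rcases le_or_gt (A1 * A2) 1 with hcase | hcase
  · have hS : ∑ i ∈ D, q i * (a i / A1) ^ 2 = A2 / A1 ^ 2 := by
      rw [hA2, Finset.sum_div]
      exact Finset.sum_congr rfl fun k _ => by ring
    refine aux_verify D hD q hq hqsum c hc 0 (fun k => a k / A1) le_rfl
      (fun k hk => div_pos (ha k hk).1 hA1p) (fun k hk => by simp) ?_ (fun k hk => Or.inl rfl) ?_
    · have : ∑ k ∈ D, q k * (a k / A1) = A1 / A1 := by
        rw [hA1, Finset.sum_div]
        exact Finset.sum_congr rfl fun k _ => by ring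
      rw [this, div_self hA1p.ne']
    · intro k hk
      right
      rw [hS, ← (ha k hk).2]
      have e : q k * (a k / A1) ^ 3 * (1 - 0 * (a k / A1)) +
          A2 / A1 ^ 2 * (0 * (a k / A1) ^ 2 - q k * a k ^ 3) =
          q k * a k ^ 3 * (1 - A1 * A2) / A1 ^ 3 := by
        field_simp
        ring
      rw [e]
      have := (ha k hk).1
      have := hq k hk
      have : 0 ≤ 1 - A1 * A2 := by linarith
      positivity
  · rcases hne.exists_eq_singleton_or_nontrivial with ⟨k, hk⟩ | hnt
    · subst hk
      have hk : k ∈ ({k} : Finset ℕ) := Finset.mem_singleton_self k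
      simp only [Finset.sum_singleton] at hqsum hA1 hA2
      have h1 := (ha k hk).2
      have h2 : 1 ≤ c k * k := by
        rw [hA1, hA2] at hcase
        rw [hqsum] at h1 hcase
        nlinarith
      refine aux_verify {k} hD q hq (by simpa using hqsum) c hc 1 (fun _ => 1) zero_le_one
        (fun _ _ => one_pos) (fun _ _ => by simp) (by simpa using hqsum) ?_
        (fun _ _ => Or.inl (by simp))
      intro j hj
      right
      rw [Finset.mem_singleton] at hj
      subst hj
      simp [hqsum]
      linarith
    · obtain ⟨w, ρ, τ, hw, hρ, hτ, hs2, hs1, hM⟩ := aux_core D hnt q (fun k => c k * k) a hq hqsum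
        (fun k hk => (ha k hk).1) (fun k hk => (ha k hk).2) hcase
      have hS : ∑ i ∈ D, q i * (τ i / ρ) ^ 2 = 1 / ρ ^ 2 := by
        rw [← hs2, Finset.sum_div]
        exact Finset.sum_congr rfl fun k _ => by ring
      have hwt : ∀ k ∈ D, w * ρ * (τ k / ρ) = w * τ k := fun k _ => by field_simp
      have hle1 : ∀ k ∈ D, q k * τ k ^ 2 ≤ 1 := by
        intro k hk
        rw [← hs2]
        exact Finset.single_le_sum (f := fun i => q i * τ i ^ 2) (fun i hi => by
          have := hq i hi
          positivity) hk
      have hF : ∀ k ∈ D, q k * (τ k / ρ) ^ 3 * (1 - w * ρ * (τ k / ρ)) +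
          (∑ i ∈ D, q i * (τ i / ρ) ^ 2) * (w * ρ * (τ k / ρ) ^ 2 - c k * k) =
          -(c k * k * ρ - (max (w * τ k ^ 2 * (1 - q k * τ k ^ 2)) 0 + q k * τ k ^ 3)) / ρ ^ 3 := by
        intro k hk
        have h1 := hle1 k hk
        have h2 : 0 ≤ 1 - q k * τ k ^ 2 := by linarith
        rw [hS, max_eq_left (by positivity)]
        field_simp
        ring
      refine aux_verify D hD q hq hqsum c hc (w * ρ) (fun k => τ k / ρ) (by positivity)
        (fun k hk => div_pos (hτ k hk) hρ) ?_ ?_ ?_ ?_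
      · intro k hk
        have h1 := hM k hk
        have h2 : auxM (q k) (c k * k) w ρ (τ k) ≤ 1 - w * τ k := min_le_right _ _
        simp only [hwt k hk]
        linarith
      · have : ∑ k ∈ D, q k * (τ k / ρ) = (∑ k ∈ D, q k * τ k) / ρ := by
          rw [Finset.sum_div]
          exact Finset.sum_congr rfl fun k _ => by ring
        rw [this, hs1, div_self hρ.ne']
      · intro k hk
        right
        simp only [hF k hk]
        have h1 := hM k hk
        have h2 : auxM (q k) (c k * k) w ρ (τ k) ≤ c k * k * ρ -
          (max (w * τ k ^ 2 * (1 - q k * τ k ^ 2)) 0 + q k * τ k ^ 3) := min_le_left _ _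
        exact div_nonpos_of_nonpos_of_nonneg (by linarith) (by positivity)
      · intro k hk
        simp only [hF k hk]
        have h1 := hM k hk
        simp only [auxM] at h1
        rcases min_choice (c k * k * ρ -
          (max (w * τ k ^ 2 * (1 - q k * τ k ^ 2)) 0 + q k * τ k ^ 3)) (1 - w * τ k) with h | h
        · right
          rw [h] at h1
          rw [h1]
          simp
        · left
          rw [h] at h1
          rw [hwt k hk]
          linarith
end

section
/- Let D be a finite set of positive integers and P : D → ℝ a degree distribution with P(i) ≥ 0, Σ_{i∈D} P(i) = 1, ⟨d⟩ := Σ_{i∈D} i P(i) > 1, and q_i := i P(i)/⟨d⟩, with q_k > 0 for all k ∈ D. Fix x_m ∈ (0,1), and for each k ∈ D let w_k : [0,1] → [0,1] be continuous and strictly increasing with w_k(0) = 0, w_k(1) = 1, and convex on [x_m, 1]. Let the per-unit costs be c_k = c_0 > 1/(1 − x_m) for every k ∈ D. Then the game with costs J^w_k(δ) = w_k(x_k(δ)) + c_0 δ_k on strategy sets Δ_k = [0, 1/c_0] possesses a degree-based equilibrium: there exists δ* ∈ Π_k Δ_k such that J^w_k(δ*) ≤ J^w_k(s, δ*_{-k})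 for every k ∈ D and s ∈ Δ_k. -/
lemma aux_tarski (a b : ℝ) (hab : a ≤ b) (A : (ℕ → ℝ) → ℕ → Set ℝ)
    (hsub : ∀ x k, A x k ⊆ Set.Icc a b) (hne : ∀ x k, (A x k).Nonempty)
    (hmono : ∀ x y : ℕ → ℝ, (∀ k, x k ∈ Set.Icc a b) → (∀ k, y k ∈ Set.Icc a b) →
      (∀ k, x k ≤ y k) → ∀ k, A x k ⊆ A y k) :
    ∃ x : ℕ → ℝ, (∀ k, x k ∈ Set.Icc a b) ∧ ∀ k, IsLUB (A x k) (x k) := by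
  have hbdd : ∀ x k, BddAbove (A x k) := fun x k => ⟨b, fun z hz => (hsub x k hz).2⟩
  have hmem : ∀ x k, sSup (A x k) ∈ Set.Icc a b := by
    intro x k
    obtain ⟨z, hz⟩ := hne x k
    exact ⟨(hsub x k hz).1.trans (le_csSup (hbdd x k) hz),
      csSup_le ⟨z, hz⟩ (fun y hy => (hsub x k hy).2)⟩
  have : Fact (a ≤ b) := ⟨hab⟩
  let T : (ℕ → Set.Icc a b) →o (ℕ → Set.Icc a b) :=
    { toFun := fun x k => ⟨sSup (A (fun i => (x i : ℝ)) k), hmem _ k⟩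
      monotone' := by
        intro x y hxy k
        refine Subtype.mk_le_mk.2 ?_
        exact csSup_le_csSup (hbdd _ _) (hne _ _)
          (hmono _ _ (fun i => (x i).2) (fun i => (y i).2) (fun i => hxy i) k) }
  have hfix := T.map_lfp
  refine ⟨fun i => (T.lfp i : ℝ), fun k => (T.lfp k).2, fun k => ?_⟩
  have h1 : sSup (A (fun i => (T.lfp i : ℝ)) k) = (T.lfp k : ℝ) :=
    congrArg Subtype.val (congrFun hfix k)
  have h2 := isLUB_csSup (hne (fun i => (T.lfp i : ℝ)) k) (hbdd _ k)
  rw [h1] at h2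
  exact h2

lemma aux_subgrad (a : ℝ) (w g : ℝ → ℝ) (C z : ℝ) (hz : z ∈ Set.Icc a 1)
    (hwc : ContinuousOn w (Set.Icc a 1)) (hconv : ConvexOn ℝ (Set.Icc a 1) w)
    (hgc : Continuous g) (hg : ∀ t ∈ Set.Icc a 1, 0 ≤ g t)
    (hlub : IsLUB {t | t ∈ Set.Icc a 1 ∧ ∀ y ∈ Set.Icc a t, (w t - w y) * g t ≤ C * (t - y)} z) :
    ∀ u ∈ Set.Icc a 1, C * (u - z) ≤ (w u - w z) * g z := by
  intro u hu
  set A := {t | t ∈ Set.Icc a 1 ∧ ∀ y ∈ Set.Icc a t, (w t - w y) * g t ≤ C * (t - y)} with hA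
  have haA : a ∈ A := by
    refine ⟨⟨le_rfl, hz.1.trans hz.2⟩, fun y hy => ?_⟩
    have : y = a := le_antisymm hy.2 hy.1
    simp [this]
  rcases lt_trichotomy u z with h | h | h
  · have hcl := hlub.mem_closure ⟨a, haA⟩
    haveI := mem_closure_iff_nhdsWithin_neBot.1 hcl
    have hwt : Filter.Tendsto w (nhdsWithin z A) (nhds (w z)) :=
      (hwc z hz).mono_left (nhdsWithin_mono _ (fun t ht => ht.1))
    have hgt : Filter.Tendsto g (nhdsWithin z A) (nhds (g z)) :=
      (hgc.tendsto z).mono_left nhdsWithin_le_nhds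
    have hid : Filter.Tendsto (fun t : ℝ => t) (nhdsWithin z A) (nhds z) :=
      Filter.tendsto_id.mono_left nhdsWithin_le_nhds
    have key : (w z - w u) * g z ≤ C * (z - u) := by
      refine le_of_tendsto_of_tendsto ((hwt.sub_const (w u)).mul hgt)
        ((hid.sub_const u).const_mul C) ?_
      filter_upwards [self_mem_nhdsWithin, nhdsWithin_le_nhds (Ioi_mem_nhds h)] with t ht htu
      exact ht.2 u ⟨hu.1, le_of_lt htu⟩
    linarith
  · subst h; simp
  · have hsubI : Set.Ioo z u ⊆ Set.Icc a 1 := fun t ht =>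
      ⟨hz.1.trans ht.1.le, ht.2.le.trans hu.2⟩
    have hIoo : Set.Ioo z u ∈ nhdsWithin z (Set.Ioi z) := Ioo_mem_nhdsGT h
    have hle : nhdsWithin z (Set.Ioi z) ≤ nhdsWithin z (Set.Icc a 1) := by
      rw [← nhdsWithin_Ioo_eq_nhdsGT h]
      exact nhdsWithin_mono _ hsubI
    have hwt : Filter.Tendsto w (nhdsWithin z (Set.Ioi z)) (nhds (w z)) :=
      (hwc z hz).mono_left hle
    have hgt : Filter.Tendsto g (nhdsWithin z (Set.Ioi z)) (nhds (g z)) :=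
      (hgc.tendsto z).mono_left nhdsWithin_le_nhds
    have hid : Filter.Tendsto (fun t : ℝ => t) (nhdsWithin z (Set.Ioi z)) (nhds z) :=
      Filter.tendsto_id.mono_left nhdsWithin_le_nhds
    refine le_of_tendsto_of_tendsto ((hid.const_sub u).const_mul C)
      ((hwt.const_sub (w u)).mul hgt) ?_
    filter_upwards [hIoo] with t ht
    have htI := hsubI ht
    have hnot : t ∉ A := fun hc => absurd (hlub.1 hc) (not_le.2 ht.1)
    have : ∃ y ∈ Set.Icc a t, C * (t - y) < (w t - w y) * g t := by
      by_contra hcon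
      push Not at hcon
      exact hnot ⟨htI, hcon⟩
    obtain ⟨y, hy, hyt⟩ := this
    have hyt' : y < t := by
      rcases lt_or_eq_of_le hy.2 with h' | h'
      · exact h'
      · subst h'; simp at hyt
    have hsl := hconv.slope_mono_adjacent ⟨hy.1, hy.2.trans htI.2⟩ hu hyt' ht.2
    have h1 : C < (w t - w y) / (t - y) * g t := by
      rw [div_mul_eq_mul_div, lt_div_iff₀ (sub_pos.2 hyt')]
      exact hyt
    have h2 : C ≤ (w u - w t) / (u - t) * g t :=
      h1.le.trans (mul_le_mul_of_nonneg_right hsl (hg t htI))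
    rw [div_mul_eq_mul_div, le_div_iff₀ (sub_pos.2 ht.2)] at h2
    exact h2

/-- the solution of the consistency equation is unique -/
lemma aux_unique (D : Finset ℕ) (hD : ∀ i ∈ D, 0 < i) (q δ : ℕ → ℝ)
    (hq : ∀ k ∈ D, 0 < q k) (hne : D.Nonempty) (hδ : ∀ k ∈ D, 0 ≤ δ k) (v v' : ℝ)
    (hv : 0 < v) (hlt : v < v') :
    ∑ i ∈ D, (i : ℝ) * q i / (δ i + (i : ℝ) * v') <
      ∑ i ∈ D, (i : ℝ) * q i / (δ i + (i : ℝ) * v) := by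
  refine Finset.sum_lt_sum_of_nonempty hne (fun i hi => ?_)
  have h1 : (0 : ℝ) < i := by exact_mod_cast hD i hi
  have h2 := hq i hi
  have h3 := hδ i hi
  have h4 : 0 < (i : ℝ) * v := by positivity
  have h5 : (i : ℝ) * v < i * v' := by gcongr
  apply div_lt_div_of_pos_left (by positivity) (by linarith) (by linarith)

lemma aux_vstar (D : Finset ℕ) (hD : ∀ i ∈ D, 0 < i) (q δ : ℕ → ℝ)
    (hq : ∀ k ∈ D, 0 < q k) (hne : D.Nonempty) (hδ : ∀ k ∈ D, 0 ≤ δ k) (v : ℝ)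
    (hv : v ∈ Set.Ioc (0 : ℝ) 1)
    (he : ∑ i ∈ D, (i : ℝ) * q i / (δ i + (i : ℝ) * v) = 1) : vstar D q δ = v := by
  have hex : ∃ v : ℝ, v ∈ Set.Ioc (0 : ℝ) 1 ∧
      ∑ i ∈ D, (i : ℝ) * q i / (δ i + (i : ℝ) * v) = 1 := ⟨v, hv, he⟩
  unfold vstar
  rw [dif_pos hex]
  obtain ⟨h1, h2⟩ := hex.choose_spec
  rcases lt_trichotomy hex.choose v with h | h | h
  · have := aux_unique D hD q δ hq hne hδ _ _ h1.1 h
    linarith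
  · exact h
  · have := aux_unique D hD q δ hq hne hδ _ _ hv.1 h
    linarith

lemma aux_exists (D : Finset ℕ) (hD : ∀ i ∈ D, 0 < i) (q δ : ℕ → ℝ)
    (hq : ∀ k ∈ D, 0 < q k) (hsum : ∑ i ∈ D, q i = 1) (e : ℝ) (he1 : e < 1) (he0 : 0 < e)
    (hδ : ∀ k ∈ D, δ k ∈ Set.Icc 0 e) :
    ∃ v ∈ Set.Icc (1 - e) 1, ∑ i ∈ D, (i : ℝ) * q i / (δ i + (i : ℝ) * v) = 1 := by
  have hc : ContinuousOn (fun v : ℝ => ∑ i ∈ D, (i : ℝ) * q i / (δ i + (i : ℝ) * v))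
      (Set.Icc (1 - e) 1) := by
    refine continuousOn_finset_sum _ (fun i hi => ?_)
    refine ContinuousOn.div continuousOn_const (by fun_prop) (fun v hv => ?_)
    have h1 : (0 : ℝ) < i := by exact_mod_cast hD i hi
    have h3 := (hδ i hi).1
    have h4 : 0 < v := by linarith [hv.1]
    positivity
  have himg := intermediate_value_Icc' (by linarith) hc
  have h1mem : (1 : ℝ) ∈ Set.Icc
      ((fun v : ℝ => ∑ i ∈ D, (i : ℝ) * q i / (δ i + (i : ℝ) * v)) 1)
      ((fun v : ℝ => ∑ i ∈ D, (i : ℝ) * q i / (δ i + (i : ℝ) * v)) (1 - e)) := by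
    constructor
    · refine le_trans (Finset.sum_le_sum (fun i hi => ?_)) hsum.le
      have h1 : (0 : ℝ) < i := by exact_mod_cast hD i hi
      have h2 := hq i hi
      have h3 := (hδ i hi).1
      rw [div_le_iff₀ (by positivity)]
      nlinarith [mul_nonneg h2.le h3]
    · refine le_trans hsum.ge (Finset.sum_le_sum (fun i hi => ?_))
      have h1 : (0 : ℝ) < i := by exact_mod_cast hD i hi
      have h1' : (1 : ℝ) ≤ i := by exact_mod_cast hD i hi
      have h2 := hq i hi
      have h3 := (hδ i hi).1
      have h3' := (hδ i hi).2
      have h4 : 0 < 1 - e := by linarith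
      rw [le_div_iff₀ (by positivity)]
      have : δ i + i * (1 - e) ≤ i := by nlinarith
      nlinarith
  obtain ⟨v, hv, hv'⟩ := himg h1mem
  exact ⟨v, hv, hv'⟩

/-- tangent inequality -/
lemma aux_tangent (D : Finset ℕ) (hD : ∀ i ∈ D, 0 < i) (q δ : ℕ → ℝ)
    (hq : ∀ k ∈ D, 0 < q k) (hδ : ∀ k ∈ D, 0 ≤ δ k) (k : ℕ) (hk : k ∈ D)
    (s v v' : ℝ) (hs : 0 ≤ s) (hv : 0 < v) (hv' : 0 < v')
    (x : ℕ → ℝ) (hx : ∀ i ∈ D, x i = i * v / (δ i + i * v))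
    (S : ℝ) (hS : S = ∑ i ∈ D, q i * x i ^ 2) (hSpos : 0 < S)
    (hvx : v = ∑ i ∈ D, q i * x i)
    (he : ∑ i ∈ D, (i : ℝ) * q i / (δ i + (i : ℝ) * v) = 1)
    (he' : ∑ i ∈ D, (i : ℝ) * q i / (Function.update δ k s i + (i : ℝ) * v') = 1) :
    -(x k ^ 2 * (1 + q k * x k * (1 - x k) / S)) * (s - δ k) ≤
      k * v * (k * v' / (s + k * v') - x k) := by
  have hkpos : (0 : ℝ) < k := by exact_mod_cast hD k hk
  have hqk := hq k hk
  -- step 1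
  have h1 : -(q k * x k ^ 2 / k) * (s - δ k) ≤ S * (v' - v) := by
    have hterm : ∀ i ∈ D, -(q i * x i ^ 2 / (i * v ^ 2)) * (Function.update δ k s i - δ i)
        - q i * x i ^ 2 / v ^ 2 * (v' - v)
        ≤ (i : ℝ) * q i / (Function.update δ k s i + (i : ℝ) * v')
          - (i : ℝ) * q i / (δ i + (i : ℝ) * v) := by
      intro i hi
      have hip : (0 : ℝ) < i := by exact_mod_cast hD i hi
      have hqi := hq i hi
      have hd := hδ i hi
      have hs' : 0 ≤ Function.update δ k s i := by
        by_cases h : i = k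
        · subst h; simpa using hs
        · simpa [h] using hd
      set d' := Function.update δ k s i
      rw [hx i hi]
      set X := δ i + i * v with hX
      set Y := d' + i * v' with hY
      have hXp : 0 < X := by positivity
      have hYp : 0 < Y := by positivity
      have e1 : -(q i * (i * v / X) ^ 2 / (i * v ^ 2)) * (d' - δ i)
        - q i * (i * v / X) ^ 2 / v ^ 2 * (v' - v) = -(i * q i / X ^ 2) * (Y - X) := by
        rw [hY]
        have : δ i = X - i * v := by rw [hX]; ring
        rw [this]
        field_simp
        ring
      have e2 : i * q i / Y - i * q i / X - -(i * q i / X ^ 2) * (Y - X)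
          = i * q i * (Y - X) ^ 2 / (Y * X ^ 2) := by
        field_simp
        ring
      have e3 : 0 ≤ i * q i * (Y - X) ^ 2 / (Y * X ^ 2) := by positivity
      rw [e1]
      linarith
    have hsum := Finset.sum_le_sum hterm
    rw [Finset.sum_sub_distrib, Finset.sum_sub_distrib, he, he',
      Finset.sum_eq_single_of_mem k hk (by intro b _ hb; simp [hb]),
      ← Finset.sum_mul, ← Finset.sum_div, ← hS] at hsum
    simp only [Function.update_self] at hsum
    have hm := mul_le_mul_of_nonneg_left hsum (sq_nonneg v)
    have e4 : v ^ 2 * (-(q k * x k ^ 2 / (k * v ^ 2)) * (s - δ k) - S / v ^ 2 * (v' - v))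
      = -(q k * x k ^ 2 / k) * (s - δ k) - S * (v' - v) := by
      field_simp
    rw [e4] at hm
    linarith
  -- step 2
  have hvx' : v' = ∑ i ∈ D, q i * (i * v' / (Function.update δ k s i + i * v')) := by
    have : ∑ i ∈ D, q i * (i * v' / (Function.update δ k s i + i * v'))
      = v' * ∑ i ∈ D, (i : ℝ) * q i / (Function.update δ k s i + (i : ℝ) * v') := by
      rw [Finset.mul_sum]
      exact Finset.sum_congr rfl (fun i _ => by ring)
    rw [this, he', mul_one]
  have h2 : (S + q k * x k * (1 - x k)) * (v' - v) ≤
      v * (q k * (k * v' / (s + k * v') - x k)) := by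
    have hterm : ∀ i ∈ D.erase k,
        v * (q i * (i * v' / (Function.update δ k s i + i * v')) - q i * x i) ≤
          (q i * x i - q i * x i ^ 2) * (v' - v) := by
      intro i hi
      have hne := Finset.ne_of_mem_erase hi
      have hi := Finset.mem_of_mem_erase hi
      have hip : (0 : ℝ) < i := by exact_mod_cast hD i hi
      have hqi := hq i hi
      have hd := hδ i hi
      rw [Function.update_of_ne hne, hx i hi]
      have hXp : 0 < δ i + i * v := by positivity
      have hYp : 0 < δ i + i * v' := by positivity
      have e2 : (q i * (i * v / (δ i + i * v)) - q i * (i * v / (δ i + i * v)) ^ 2) * (v' - v)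
        - v * (q i * (i * v' / (δ i + i * v')) - q i * (i * v / (δ i + i * v)))
          = q i * v * i ^ 2 * δ i * (v' - v) ^ 2 / ((δ i + i * v') * (δ i + i * v) ^ 2) := by
        field_simp
        ring
      have e3 : 0 ≤ q i * v * i ^ 2 * δ i * (v' - v) ^ 2 /
          ((δ i + i * v') * (δ i + i * v) ^ 2) := by positivity
      linarith
    have hsum := Finset.sum_le_sum hterm
    rw [← Finset.mul_sum, ← Finset.sum_mul, Finset.sum_sub_distrib, Finset.sum_sub_distrib] at hsum
    have a1 := Finset.add_sum_erase D (fun i => q i * (i * v' / (Function.update δ k s i + i * v'))) hk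
    have a2 := Finset.add_sum_erase D (fun i => q i * x i) hk
    have a3 := Finset.add_sum_erase D (fun i => q i * x i ^ 2) hk
    rw [← hvx'] at a1
    rw [← hvx] at a2
    rw [← hS] at a3
    simp only [Function.update_self] at a1 a2 a3
    rw [← eq_sub_iff_add_eq'] at a1 a2 a3
    rw [a1, a2, a3] at hsum
    nlinarith
  have hxk : 0 ≤ x k ∧ x k ≤ 1 := by
    rw [hx k hk]
    have := hδ k hk
    have hX : 0 < δ k + k * v := by positivity
    exact ⟨by positivity, by rw [div_le_one hX]; linarith⟩
  have hG : 0 ≤ (S + q k * x k * (1 - x k)) := by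
    have : 0 ≤ 1 - x k := by linarith [hxk.2]
    have := hxk.1
    positivity
  have h3 := mul_le_mul_of_nonneg_left h1 hG
  have h4 := mul_le_mul_of_nonneg_left h2 hSpos.le
  have h5 : (S + q k * x k * (1 - x k)) * (-(q k * x k ^ 2 / k) * (s - δ k)) ≤
      S * (v * (q k * (k * v' / (s + k * v') - x k))) := by linarith
  have hf : 0 < k / (S * q k) := by positivity
  have h6 := mul_le_mul_of_nonneg_left h5 hf.le
  have e5 : k / (S * q k) * ((S + q k * x k * (1 - x k)) * (-(q k * x k ^ 2 / k) * (s - δ k)))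
     = -(x k ^ 2 * (1 + q k * x k * (1 - x k) / S)) * (s - δ k) := by
    field_simp
  have e6 : k / (S * q k) * (S * (v * (q k * (k * v' / (s + k * v') - x k)))) =
      k * v * (k * v' / (s + k * v') - x k) := by
    generalize (k * v' / (s + k * v') - x k) = Z
    field_simp
  rw [e5, e6] at h6
  exact h6

/-- Under a degree distribution `P` with average degree `⟨d⟩ > 1` and
neighbor weights `q_i = i P(i)/⟨d⟩` positive on `D`, fix `x_m ∈ (0,1)`, let each degree
class `k` have a probability weighting function `w_k : [0,1] → [0,1]`, continuous,
strictly increasing, with `w_k(0) = 0`, `w_k(1) = 1`, and convex on `[x_m, 1]`, and let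
the homogeneous per-unit cost satisfy `c₀ > 1/(1 - x_m)`. Then the game with perceived
costs `J^w_k(δ) = w_k(x_k(δ)) + c₀ δ_k` on strategy sets `[0, 1/c₀]` possesses a
degree-based equilibrium. -/
theorem dbe_exists_probability_weighting
    (D : Finset ℕ) (hD : ∀ i ∈ D, 0 < i)
    (P : ℕ → ℝ) (hP : ∀ i ∈ D, 0 ≤ P i) (hPsum : ∑ i ∈ D, P i = 1)
    (davg : ℝ) (hdavg : davg = ∑ i ∈ D, (i : ℝ) * P i) (hd1 : 1 < davg)
    (q : ℕ → ℝ) (hq : ∀ i, q i = (i : ℝ) * P i / davg) (hqpos : ∀ k ∈ D, 0 < q k)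
    (xm : ℝ) (hxm : xm ∈ Set.Ioo (0 : ℝ) 1)
    (w : ℕ → ℝ → ℝ)
    (hwcont : ∀ k ∈ D, ContinuousOn (w k) (Set.Icc 0 1))
    (hwmono : ∀ k ∈ D, StrictMonoOn (w k) (Set.Icc 0 1))
    (hw0 : ∀ k ∈ D, w k 0 = 0) (hw1 : ∀ k ∈ D, w k 1 = 1)
    (hwrange : ∀ k ∈ D, ∀ x ∈ Set.Icc (0 : ℝ) 1, w k x ∈ Set.Icc (0 : ℝ) 1)
    (hwconv : ∀ k ∈ D, ConvexOn ℝ (Set.Icc xm 1) (w k))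
    (c₀ : ℝ) (hc₀ : 1 / (1 - xm) < c₀) :
    ∃ δstar : ℕ → ℝ,
      (∀ k ∈ D, δstar k ∈ Set.Icc (0 : ℝ) (1 / c₀)) ∧
      ∀ k ∈ D, ∀ s ∈ Set.Icc (0 : ℝ) (1 / c₀),
        w k (xinf D q δstar k) + c₀ * δstar k
          ≤ w k (xinf D q (Function.update δstar k s) k) + c₀ * s := by
  have hdpos : 0 < davg := by linarith
  have hqsum : ∑ i ∈ D, q i = 1 := by
    simp only [hq]
    rw [← Finset.sum_div, ← hdavg, div_self hdpos.ne']
  have hne : D.Nonempty := by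
    rcases D.eq_empty_or_nonempty with h | h
    · rw [h] at hPsum; simp at hPsum
    · exact h
  obtain ⟨hxm0, hxm1⟩ := hxm
  have h1xm : 0 < 1 - xm := by linarith
  have hc0 : 0 < c₀ := lt_trans (by positivity) hc₀
  have hinv : 1 / c₀ < 1 - xm := by
    rw [div_lt_iff₀ h1xm] at hc₀
    rw [div_lt_iff₀ hc0]; linarith
  have hinv0 : 0 < 1 / c₀ := by positivity
  -- the fixed point
  let V : (ℕ → ℝ) → ℝ := fun x => ∑ i ∈ D, q i * x i
  let SS : (ℕ → ℝ) → ℝ := fun x => ∑ i ∈ D, q i * x i ^ 2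
  let G : (ℕ → ℝ) → ℕ → ℝ → ℝ := fun x k t => t ^ 2 * (1 + q k * t * (1 - t) / SS x)
  have hSSpos : ∀ x : ℕ → ℝ, (∀ k, x k ∈ Set.Icc xm 1) → 0 < SS x := by
    intro x hx
    refine Finset.sum_pos (fun i hi => ?_) hne
    have := hqpos i hi
    have : 0 < x i := lt_of_lt_of_le hxm0 (hx i).1
    positivity
  let A : (ℕ → ℝ) → ℕ → Set ℝ := fun x k => {t | t ∈ Set.Icc xm 1 ∧
    (k ∈ D → ∀ y ∈ Set.Icc xm t, (w k t - w k y) * G x k t ≤ (c₀ * k * V x) * (t - y))}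
  have hsubI : Set.Icc xm 1 ⊆ Set.Icc 0 1 := Set.Icc_subset_Icc_left hxm0.le
  obtain ⟨x, hxI, hxlub⟩ := aux_tarski xm 1 hxm1.le A (fun x k t ht => ht.1)
    (fun x k => ⟨xm, ⟨le_rfl, hxm1.le⟩, fun _ y hy => by
      have : y = xm := le_antisymm hy.2 hy.1
      simp [this]⟩)
    (by
      intro x y hx hy hxy k t ht
      refine ⟨ht.1, fun hk z hz => ?_⟩
      have h1 := ht.2 hk z hz
      have hw : 0 ≤ w k t - w k z := by
        have hzI : z ∈ Set.Icc xm 1 := ⟨hz.1, hz.2.trans ht.1.2⟩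
        have := (hwmono k hk).monotoneOn (hsubI hzI) (hsubI ht.1) hz.2
        linarith
      have hV : V x ≤ V y := Finset.sum_le_sum (fun i hi =>
        mul_le_mul_of_nonneg_left (hxy i) (hqpos i hi).le)
      have hS : SS x ≤ SS y := Finset.sum_le_sum (fun i hi =>
        mul_le_mul_of_nonneg_left
          (pow_le_pow_left₀ (hxm0.le.trans (hx i).1) (hxy i) 2) (hqpos i hi).le)
      have hSx := hSSpos x hx
      have hqk := hqpos k hk
      have ht0 : 0 < t := lt_of_lt_of_le hxm0 ht.1.1
      have ht1 : 0 ≤ 1 - t := by linarith [ht.1.2]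
      have hG : G y k t ≤ G x k t := by
        show t ^ 2 * (1 + q k * t * (1 - t) / SS y) ≤ t ^ 2 * (1 + q k * t * (1 - t) / SS x)
        gcongr
      have htz : 0 ≤ t - z := by linarith [hz.2]
      calc (w k t - w k z) * G y k t ≤ (w k t - w k z) * G x k t :=
            mul_le_mul_of_nonneg_left hG hw
        _ ≤ (c₀ * k * V x) * (t - z) := h1
        _ ≤ (c₀ * k * V y) * (t - z) := by gcongr)
  have hxpos : ∀ i, 0 < x i := fun i => lt_of_lt_of_le hxm0 (hxI i).1
  have hSpos := hSSpos x hxI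
  have hvpos : 0 < V x := Finset.sum_pos (fun i hi => mul_pos (hqpos i hi) (hxpos i)) hne
  have hv1 : V x ≤ 1 := by
    rw [← hqsum]
    refine Finset.sum_le_sum (fun i hi => ?_)
    nlinarith [hqpos i hi, (hxI i).2]
  have hGpos : ∀ k ∈ D, ∀ t ∈ Set.Icc xm 1, 0 < G x k t := by
    intro k hk t ht
    have ht0 : 0 < t := lt_of_lt_of_le hxm0 ht.1
    have ht1 : 0 ≤ 1 - t := by linarith [ht.2]
    have hqk := hqpos k hk
    show 0 < t ^ 2 * (1 + q k * t * (1 - t) / SS x)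
    positivity
  have hsubg : ∀ k ∈ D, ∀ u ∈ Set.Icc xm 1,
      (c₀ * k * V x) * (u - x k) ≤ (w k u - w k (x k)) * G x k (x k) := by
    intro k hk
    refine aux_subgrad xm (w k) (G x k) (c₀ * k * V x) (x k) (hxI k)
      ((hwcont k hk).mono hsubI) (hwconv k hk) ?_ (fun t ht => (hGpos k hk t ht).le) ?_
    · show Continuous (fun t : ℝ => t ^ 2 * (1 + q k * t * (1 - t) / SS x))
      fun_prop
    · have := hxlub k
      simpa only [A, hk, true_imp_iff] using this
  set v := V x with hvdef
  let δ : ℕ → ℝ := fun k => k * v * (1 - x k) / x k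
  have hδ0 : ∀ k ∈ D, 0 ≤ δ k := by
    intro k hk
    have h1 : 0 ≤ 1 - x k := by linarith [(hxI k).2]
    have h2 := hxpos k
    show 0 ≤ k * v * (1 - x k) / x k
    positivity
  have hδx : ∀ k ∈ D, δ k + k * v = k * v / x k := by
    intro k hk
    have h2 := hxpos k
    show k * v * (1 - x k) / x k + k * v = k * v / x k
    field_simp
    ring
  have hxeq : ∀ k ∈ D, x k = k * v / (δ k + k * v) := by
    intro k hk
    have h2 := hxpos k
    have h1 : (0 : ℝ) < k := by exact_mod_cast hD k hk
    rw [hδx k hk]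
    field_simp
  have heq : ∑ i ∈ D, (i : ℝ) * q i / (δ i + (i : ℝ) * v) = 1 := by
    have : ∑ i ∈ D, (i : ℝ) * q i / (δ i + (i : ℝ) * v) = ∑ i ∈ D, q i * x i / v := by
      refine Finset.sum_congr rfl (fun i hi => ?_)
      have h2 := hxpos i
      have h1 : (0 : ℝ) < i := by exact_mod_cast hD i hi
      rw [hδx i hi]
      field_simp
    rw [this, ← Finset.sum_div]
    exact div_self hvpos.ne'
  have hδ1 : ∀ k ∈ D, δ k ≤ 1 / c₀ := by
    intro k hk
    have h2 := hxpos k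
    have h1 : (0 : ℝ) < k := by exact_mod_cast hD k hk
    have hx1 := (hxI k).2
    have hqk := hqpos k hk
    have hs := hsubg k hk 1 ⟨hxm1.le, le_rfl⟩
    rw [hw1 k hk] at hs
    have hwx := hwrange k hk (x k) (hsubI (hxI k))
    have hSk : q k * x k ^ 2 ≤ SS x :=
      Finset.single_le_sum (f := fun i => q i * x i ^ 2)
        (fun i hi => mul_nonneg (hqpos i hi).le (sq_nonneg _)) hk
    have hGx : G x k (x k) ≤ x k := by
      show x k ^ 2 * (1 + q k * x k * (1 - x k) / SS x) ≤ x k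
      have hfr : q k * x k ^ 2 / SS x ≤ 1 := by rw [div_le_one hSpos]; exact hSk
      have e : x k ^ 2 * (1 + q k * x k * (1 - x k) / SS x) =
        x k ^ 2 + x k * (1 - x k) * (q k * x k ^ 2 / SS x) := by field_simp
      rw [e]
      have := mul_le_mul_of_nonneg_left hfr
        (mul_nonneg h2.le (by linarith : 0 ≤ 1 - x k))
      nlinarith
    have hGp := hGpos k hk (x k) (hxI k)
    have h5 : (1 - w k (x k)) * G x k (x k) ≤ x k := by nlinarith [hwx.1, hwx.2]
    show k * v * (1 - x k) / x k ≤ 1 / c₀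
    rw [div_le_div_iff₀ h2 hc0]
    linarith
  refine ⟨δ, fun k hk => ⟨hδ0 k hk, hδ1 k hk⟩, fun k hk s hs => ?_⟩
  have hkpos : (0 : ℝ) < k := by exact_mod_cast hD k hk
  have hvs : vstar D q δ = v := aux_vstar D hD q δ hqpos hne hδ0 v ⟨hvpos, hv1⟩ heq
  have hxinf : xinf D q δ k = x k := by
    unfold xinf
    rw [hvs, if_pos hvpos, ← hxeq k hk]
  have hupd : ∀ i ∈ D, Function.update δ k s i ∈ Set.Icc 0 (1 / c₀) := by
    intro i hi
    by_cases h : i = k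
    · subst h; simpa using hs
    · rw [Function.update_of_ne h]; exact ⟨hδ0 i hi, hδ1 i hi⟩
  obtain ⟨v', hv'I, hv'e⟩ := aux_exists D hD q (Function.update δ k s) hqpos hqsum (1 / c₀)
    (by linarith) hinv0 hupd
  have hv'pos : 0 < v' := by linarith [hv'I.1]
  have hvs' : vstar D q (Function.update δ k s) = v' :=
    aux_vstar D hD q _ hqpos hne (fun i hi => (hupd i hi).1) v' ⟨hv'pos, hv'I.2⟩ hv'e
  have hxinf' : xinf D q (Function.update δ k s) k = k * v' / (s + k * v') := by
    unfold xinf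
    rw [hvs', if_pos hv'pos, Function.update_self]
  rw [hxinf, hxinf']
  have hden : 0 < s + k * v' := by have := hs.1; positivity
  have hx'I : k * v' / (s + k * v') ∈ Set.Icc xm 1 := by
    constructor
    · rw [le_div_iff₀ hden]
      have hk1 : (1 : ℝ) ≤ k := by exact_mod_cast hD k hk
      have hsx : s ≤ 1 - xm := hs.2.trans hinv.le
      have hv'm : xm ≤ v' := by linarith [hv'I.1]
      have h1 : xm * s ≤ xm * (1 - xm) := mul_le_mul_of_nonneg_left hsx hxm0.le
      have h2 : xm * (1 - xm) ≤ v' * (1 - xm) := mul_le_mul_of_nonneg_right hv'm h1xm.le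
      have h3 : v' * (1 - xm) ≤ k * (v' * (1 - xm)) :=
        le_mul_of_one_le_left (by positivity) hk1
      nlinarith
    · rw [div_le_one hden]; linarith [hs.1]
  have htan := aux_tangent D hD q δ hqpos hδ0 k hk s v v' hs.1 hvpos hv'pos x hxeq (SS x) rfl
    hSpos rfl heq hv'e
  have hsg := hsubg k hk _ hx'I
  have hGp := hGpos k hk (x k) (hxI k)
  have htan' : -(G x k (x k)) * (s - δ k) ≤ k * v * (k * v' / (s + k * v') - x k) := htan
  have hfin : (-(c₀ * (s - δ k))) * G x k (x k) ≤
      (w k (k * v' / (s + k * v')) - w k (x k)) * G x k (x k) := by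
    have := mul_le_mul_of_nonneg_left htan' hc0.le
    linarith
  have := le_of_mul_le_mul_right hfin hGp
  linarith
end
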